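/- arXiv:1904.11380 — 5 statements merged into one kernel-verified Lean document; each statement's English description precedes it below -/
import Mathlib

section
/- sup_{n∈ℕ} n·b_n² = ∞; in fact along the perfect squares n = l² one has n·b_n² = l^{1/2} → ∞ as l → ∞. -/
open Filter

/-- With `b : {1,2,...} → ℝ` defined by `b k = k^(-3/8)` if `k` is a perfect square and
`b k = 1/k` otherwise, one has `sup_n n * (b n)^2 = ∞`; in fact along the perfect squares
`n = l²` one has `n * (b n)^2 = l^(1/2) → ∞` as `l → ∞`. -/
theorem sup_n_mul_b_sq_eq_top (b : ℕ+ → ℝ)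
    (hb1 : ∀ k : ℕ+, (∃ l : ℕ+, k = l ^ 2) → b k = ((k : ℕ) : ℝ) ^ (-(3 / 8 : ℝ)))
    (hb2 : ∀ k : ℕ+, (¬ ∃ l : ℕ+, k = l ^ 2) → b k = 1 / ((k : ℕ) : ℝ)) :
    (⨆ n : ℕ+, ENNReal.ofReal (((n : ℕ) : ℝ) * b n ^ 2) = ⊤) ∧
    (∀ l : ℕ+, (((l ^ 2 : ℕ+) : ℕ) : ℝ) * b (l ^ 2) ^ 2 = ((l : ℕ) : ℝ) ^ ((1 : ℝ) / 2)) ∧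
    Tendsto (fun l : ℕ+ => (((l ^ 2 : ℕ+) : ℕ) : ℝ) * b (l ^ 2) ^ 2) atTop atTop := by
  have hval (l : ℕ+) :
      (((l ^ 2 : ℕ+) : ℕ) : ℝ) * b (l ^ 2) ^ 2 = ((l : ℕ) : ℝ) ^ ((1 : ℝ) / 2) := by
    have hl : (0 : ℝ) < ((l : ℕ) : ℝ) := by exact_mod_cast l.pos
    rw [hb1 _ ⟨l, rfl⟩, PNat.pow_coe, Nat.cast_pow, ← Real.rpow_natCast, ← Real.rpow_natCast,
      ← Real.rpow_mul hl.le, ← Real.rpow_mul hl.le, ← Real.rpow_add hl]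
    norm_num
  have hcoe : Tendsto (fun l : ℕ+ => ((l : ℕ) : ℝ)) atTop atTop :=
    tendsto_natCast_atTop_atTop.comp tendsto_PNat_val_atTop_atTop
  have hlim : Tendsto (fun l : ℕ+ => (((l ^ 2 : ℕ+) : ℕ) : ℝ) * b (l ^ 2) ^ 2) atTop atTop := by
    simp only [hval]
    exact (tendsto_rpow_atTop (by norm_num)).comp hcoe
  refine ⟨top_unique ?_, hval, hlim⟩
  exact le_of_tendsto' (ENNReal.tendsto_ofReal_atTop.comp hlim)
    fun l => le_iSup (fun n : ℕ+ => ENNReal.ofReal (((n : ℕ) : ℝ) * b n ^ 2)) (l ^ 2)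
end

section
/- Let A be the unbounded operator on X = ℓ²(ℕ,ℂ) with domain D(A) = {x ∈ X : (λ₀(k)x_k)_k ∈ X} defined by (Ax)_k = λ₀(k)·x_k − b_k·⟨x,b⟩ (that is, A = A₀ − BB* with Bu = (u b_k)_k). Then there do not exist constants M ≥ 1 and ω < 0 such that for every z ∈ ℂ with Re z > ω the operator A − z : D(A) → X is bijective with bounded inverse satisfying ‖(A−z)^{-1}‖ ≤ M/(Re z − ω). (Indeed (A − λ₀(n))e_n = −b_n·b with ‖b_n·b‖ → 0 while ‖e_n‖ = 1.) -/
open MeasureTheory Filter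

/-- The squares of the positive integers tend to infinity. -/
theorem tendsto_coe_sq_atTop :
    Tendsto (fun m : ℕ+ => ((m ^ 2 : ℕ+) : ℕ)) atTop atTop := by
  refine tendsto_atTop.2 fun N => ?_
  filter_upwards [eventually_ge_atTop N.succPNat] with m hm
  have h : N + 1 ≤ (m : ℕ) := hm
  rw [PNat.pow_coe]
  nlinarith

/-- For square indices `n = m ^ 2`, the sequence `n ^ (-3/8)` tends to zero. -/
theorem tendsto_sq_rpow_neg_three_eighths :
    Tendsto (fun m : ℕ+ => (((m ^ 2 : ℕ+) : ℕ) : ℝ) ^ (-(3 / 8 : ℝ))) atTop (nhds 0) := by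
  refine (tendsto_rpow_neg_atTop (by norm_num)).comp ?_
  exact tendsto_natCast_atTop_atTop.comp tendsto_coe_sq_atTop

/-- The semigroup generated by `A = A₀ - BB*`, i.e. by the operator
`(A x)_k = λ₀(k) x_k - b_k ⟨x, b⟩` on `X = ℓ²(ℕ,ℂ)` with domain
`D(A) = {x : (λ₀(k) x_k)_k ∈ X}`, is not exponentially stable: there are no constants
`M ≥ 1` and `ω < 0` such that for every `z` with `Re z > ω` the operator `A - z` maps
`D(A)` bijectively onto `X` with a bounded inverse satisfying
`‖(A - z)⁻¹‖ ≤ M / (Re z - ω)`. -/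
theorem not_exponentially_stable
    (β : ℕ+ → ℝ) (hβ : Tendsto β atTop atTop)
    (lam : ℕ+ → ℂ) (hlam : ∀ k : ℕ+, lam k = -1 / ((k : ℕ) : ℂ) + Complex.I * (β k : ℂ))
    (b : ℕ+ → ℝ)
    (hb1 : ∀ k : ℕ+, (∃ l : ℕ+, k = l ^ 2) → b k = ((k : ℕ) : ℝ) ^ (-(3 / 8 : ℝ)))
    (hb2 : ∀ k : ℕ+, (¬ ∃ l : ℕ+, k = l ^ 2) → b k = 1 / ((k : ℕ) : ℝ)) :
    ¬ ∃ (M ω : ℝ), 1 ≤ M ∧ ω < 0 ∧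
      ∀ z : ℂ, ω < z.re →
        (∀ y : lp (fun _ : ℕ+ => ℂ) 2, ∃! x : lp (fun _ : ℕ+ => ℂ) 2,
          Memℓp (fun k : ℕ+ => lam k * x k) 2 ∧
          ∀ k : ℕ+,
            (lam k * x k -
              ((b k : ℝ) : ℂ) * ∑' j : ℕ+, x j * (starRingEnd ℂ) ((b j : ℝ) : ℂ)) -
              z * x k = y k) ∧
        (∀ x : lp (fun _ : ℕ+ => ℂ) 2, Memℓp (fun k : ℕ+ => lam k * x k) 2 →
          ‖x‖ ≤ M / (z.re - ω) *
            Real.sqrt (∑' k : ℕ+,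
              ‖(lam k * x k -
                  ((b k : ℝ) : ℂ) * ∑' j : ℕ+, x j * (starRingEnd ℂ) ((b j : ℝ) : ℂ)) -
                z * x k‖ ^ 2)) := by
  rintro ⟨M, ω, -, hω, H⟩
  set S : ℝ := ∑' k : ℕ+, b k ^ 2
  have hsq : Tendsto (fun m : ℕ+ => (((m ^ 2 : ℕ+) : ℕ) : ℝ)) atTop atTop :=
    tendsto_natCast_atTop_atTop.comp tendsto_coe_sq_atTop
  have hb : Tendsto (fun m : ℕ+ => b (m ^ 2)) atTop (nhds 0) :=
    tendsto_sq_rpow_neg_three_eighths.congr fun m => (hb1 _ ⟨m, rfl⟩).symm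
  have hre : ∀ k : ℕ+, (lam k).re = -((k : ℕ) : ℝ)⁻¹ := fun k => by
    rw [hlam, neg_div, one_div, ← Complex.ofReal_natCast, ← Complex.ofReal_inv]
    simp
  have hlim : Tendsto (fun m : ℕ+ => (lam (m ^ 2)).re) atTop (nhds 0) := by
    simp only [hre]
    simpa using hsq.inv_tendsto_atTop.neg
  have hresolvent : ∀ᶠ m : ℕ+ in atTop,
      1 ≤ M / ((lam (m ^ 2)).re - ω) * Real.sqrt (b (m ^ 2) ^ 2 * S) := by
    filter_upwards [hlim.eventually (lt_mem_nhds hω)] with m hm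
    set n : ℕ+ := m ^ 2
    set e : lp (fun _ : ℕ+ => ℂ) 2 := lp.single 2 n (1 : ℂ)
    have he : ∀ k, e k = if k = n then 1 else 0 := fun k => by
      simp [e, Pi.single_apply]
    have hmem : Memℓp (fun k : ℕ+ => lam k * e k) 2 := by
      convert lp.memℓp (lam n • e) using 2 with k
      by_cases hk : k = n <;> simp [he, hk]
    have hpair : ∑' j : ℕ+, e j * (starRingEnd ℂ) ((b j : ℝ) : ℂ) = b n := by
      rw [tsum_eq_single n fun k hk => by simp [he, hk]]
      simp [he]
    have hnorm : ‖e‖ = 1 := by simp [e, lp.norm_single]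
    have hbound := (H (lam n) hm).2 e hmem
    rw [hpair, hnorm] at hbound
    have hterm : ∀ k : ℕ+,
        ‖(lam k * e k - (b k : ℂ) * b n) - lam n * e k‖ ^ 2 = b n ^ 2 * b k ^ 2 := fun k => by
      have : (lam k * e k - (b k : ℂ) * b n) - lam n * e k = -((b n * b k : ℝ) : ℂ) := by
        by_cases hk : k = n
        · subst hk; push_cast; ring
        · simp only [he, hk, if_false]; push_cast; ring
      rw [this, norm_neg, Complex.norm_real, Real.norm_eq_abs, sq_abs, mul_pow]
    simpa only [hterm, tsum_mul_left] using hbound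
  have hzero : Tendsto
      (fun m : ℕ+ => M / ((lam (m ^ 2)).re - ω) * Real.sqrt (b (m ^ 2) ^ 2 * S))
      atTop (nhds 0) := by
    have h1 := (tendsto_const_nhds (x := M)).div (hlim.sub_const ω) (by linarith)
    simpa using h1.mul ((hb.pow 2).mul_const S).sqrt
  exact absurd (ge_of_tendsto hzero hresolvent) (by norm_num)
end

section
/- There exists a constant M ≥ 0 such that for every z ∈ ℂ with Re z > 0 one has ∑_{k∈ℤ} |b_k|²/|z − λ_k|² ≤ M/(Re z). -/
open Filter

/-- A point at distance at least `a` to the left of the imaginary axis contributes at most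
`c / Re z` to the resolvent sum as soon as its weight is at most `c * a`. -/
lemma div_norm_sub_sq_le_div_re {z w : ℂ} {a c β : ℝ} (hz : 0 < z.re) (ha : 0 < a)
    (hw : w.re = -a) (hβ : 0 ≤ β) (hβc : β ≤ c * a) :
    β / ‖z - w‖ ^ 2 ≤ c / z.re := by
  have hnorm : z.re + a ≤ ‖z - w‖ := by
    simpa [hw] using Complex.re_le_norm (z - w)
  have hsq : a * z.re ≤ ‖z - w‖ ^ 2 := by
    nlinarith [mul_pos ha hz]
  calc β / ‖z - w‖ ^ 2 ≤ β / (a * z.re) := by gcongr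
    _ ≤ c * a / (a * z.re) := by gcongr
    _ = c / z.re := by field_simp

/-- The Grabowski–Weiss resolvent condition for infinite-time admissibility of
`B u = (u b_k)_k` for the diagonal generator `A x = (λ_k x_k)_k` on `ℓ²(ℤ,ℂ)`: there is a
constant `M ≥ 0` such that `∑_{k∈ℤ} |b_k|²/|z - λ_k|² ≤ M / Re z` for every `z` with
`Re z > 0`. -/
theorem resolvent_condition_holds
    (lam : ℤ → ℂ)
    (hlam1 : ∀ k : ℤ, 1 ≤ k → lam k = -(((k : ℝ) ^ (-(1 / 2 : ℝ)) : ℝ) : ℂ) + Complex.I * (k : ℂ))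
    (hlam2 : ∀ k : ℤ, k ≤ 0 → lam k = -((Real.sqrt (|(k : ℝ)| + 1) : ℝ) : ℂ))
    (b : ℤ → ℝ)
    (hb1 : ∀ k : ℤ, 1 ≤ k → b k = 1 / (k : ℝ))
    (hb0 : b 0 = 0)
    (hb2 : ∀ k : ℤ, k ≤ -1 → b k = |(k : ℝ)| ^ (-(1 / 2 : ℝ))) :
    ∃ M : ℝ, 0 ≤ M ∧ ∀ z : ℂ, 0 < z.re →
      (∑' k : ℤ, b k ^ 2 / ‖z - lam k‖ ^ 2) ≤ M / z.re := by
  have hsum : Summable fun k : ℤ => |(k : ℝ)| ^ (-(3 / 2) : ℝ) :=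
    Real.summable_abs_int_rpow (by norm_num)
  refine ⟨∑' k : ℤ, |(k : ℝ)| ^ (-(3 / 2) : ℝ), tsum_nonneg fun k => by positivity, ?_⟩
  intro z hz
  have hle (k : ℤ) : b k ^ 2 / ‖z - lam k‖ ^ 2 ≤ |(k : ℝ)| ^ (-(3 / 2) : ℝ) / z.re := by
    rcases lt_trichotomy k 0 with hk | rfl | hk
    · have hpos : 0 < |(k : ℝ)| := by simpa using hk.ne
      refine div_norm_sub_sq_le_div_re (a := √(|(k : ℝ)| + 1)) hz (by positivity)
        (by simp [hlam2 k hk.le]) (sq_nonneg _) ?_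
      calc b k ^ 2 = |(k : ℝ)| ^ (-(3 / 2) : ℝ) * √|(k : ℝ)| := by
            rw [hb2 k (by lia), Real.sqrt_eq_rpow, ← Real.rpow_mul_natCast hpos.le,
              ← Real.rpow_add hpos]
            norm_num
        _ ≤ |(k : ℝ)| ^ (-(3 / 2) : ℝ) * √(|(k : ℝ)| + 1) := by
            gcongr
            linarith
    · simp only [hb0]
      norm_num
    · have hpos : (0 : ℝ) < k := by exact_mod_cast hk
      refine div_norm_sub_sq_le_div_re (a := (k : ℝ) ^ (-(1 / 2 : ℝ))) hz (by positivity)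
        ?_ (sq_nonneg _) ?_
      · rw [hlam1 k hk, Complex.add_re, Complex.neg_re, Complex.ofReal_re]
        simp
      · rw [hb1 k hk, abs_of_pos hpos, ← Real.rpow_add hpos, one_div, inv_pow,
          ← Real.rpow_natCast, ← Real.rpow_neg hpos.le]
        norm_num
  have hsum' := hsum.div_const z.re
  rw [← tsum_div_const]
  exact (hsum'.of_nonneg_of_le (fun k => by positivity) hle).tsum_le_tsum hle hsum'
end

section
/- For every n ∈ ℕ, setting z_n := e^{-n} + i n (which has Re z_n > 0), one has Re z_n · ∑_{k∈ℤ} |b_k|²/|z_n − λ'_k|² ≥ e^{n}/(4 n²); consequently sup{ Re z · ∑_{k∈ℤ} |b_k|²/|z − λ'_k|² : z ∈ ℂ, Re z > 0 } = ∞. -/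
open Filter

/-- The resolvent series converges at every point of the open right half-plane: its terms are
dominated by `(1 / (Re z) ^ 2 + 1) / k ^ 2`. -/
theorem summable_sq_div_norm_sub_sq
    (lam' : ℤ → ℂ)
    (hlam'1 : ∀ k : ℤ, 1 ≤ k → lam' k = -((Real.exp (-(k : ℝ)) : ℝ) : ℂ) + Complex.I * (k : ℂ))
    (hlam'2 : ∀ k : ℤ, k ≤ 0 → lam' k = -((Real.sqrt (|(k : ℝ)| + 1) : ℝ) : ℂ))
    (b : ℤ → ℝ)
    (hb1 : ∀ k : ℤ, 1 ≤ k → b k = 1 / (k : ℝ))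
    (hb0 : b 0 = 0)
    (hb2 : ∀ k : ℤ, k ≤ -1 → b k = |(k : ℝ)| ^ (-(1 / 2 : ℝ)))
    {z : ℂ} (hz : 0 < z.re) :
    Summable fun k : ℤ => b k ^ 2 / ‖z - lam' k‖ ^ 2 := by
  have hsum : Summable fun k : ℤ => (1 / z.re ^ 2 + 1) * (1 / (k : ℝ) ^ 2) :=
    (Real.summable_one_div_int_pow.mpr one_lt_two).mul_left _
  refine hsum.of_nonneg_of_le (fun k => by positivity) fun k => ?_
  rcases lt_trichotomy k 0 with hk | rfl | hk
  · have hk' : 0 < |(k : ℝ)| := abs_pos.mpr (by exact_mod_cast hk.ne)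
    have hb : b k ^ 2 = 1 / |(k : ℝ)| := by
      rw [hb2 k (by omega), ← Real.rpow_natCast, ← Real.rpow_mul hk'.le]
      norm_num [Real.rpow_neg_one]
    have hdist : |(k : ℝ)| ≤ ‖z - lam' k‖ ^ 2 := by
      have hre : Real.sqrt (|(k : ℝ)| + 1) ≤ ‖z - lam' k‖ := by
        refine le_trans ?_ (Complex.re_le_norm _)
        rw [hlam'2 k hk.le]
        simp [hz.le]
      have hsq := pow_le_pow_left₀ (Real.sqrt_nonneg _) hre 2
      rw [Real.sq_sqrt (by positivity)] at hsq
      linarith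
    calc b k ^ 2 / ‖z - lam' k‖ ^ 2 ≤ 1 / |(k : ℝ)| / |(k : ℝ)| := by
          rw [hb]; gcongr
      _ = 1 / (k : ℝ) ^ 2 := by rw [div_div, abs_mul_abs_self, sq]
      _ ≤ (1 / z.re ^ 2 + 1) * (1 / (k : ℝ) ^ 2) :=
          le_mul_of_one_le_left (by positivity) (le_add_of_nonneg_left (by positivity))
  · simp [hb0]
  · have hdist : z.re ≤ ‖z - lam' k‖ := by
      refine le_trans ?_ (Complex.re_le_norm _)
      rw [hlam'1 k hk]
      simp [-Complex.ofReal_exp, (Real.exp_pos _).le]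
    calc b k ^ 2 / ‖z - lam' k‖ ^ 2 ≤ (1 / (k : ℝ)) ^ 2 / z.re ^ 2 := by
          rw [hb1 k hk]; gcongr
      _ = 1 / z.re ^ 2 * (1 / (k : ℝ) ^ 2) := by ring
      _ ≤ (1 / z.re ^ 2 + 1) * (1 / (k : ℝ) ^ 2) := by gcongr; linarith

/-- For `z_n := e^{-n} + i n` one has `Re z_n > 0` and
`Re z_n · ∑_{k∈ℤ} |b_k|²/|z_n - λ'_k|² ≥ eⁿ/(4n²)`; consequently
`sup { Re z · ∑_{k∈ℤ} |b_k|²/|z - λ'_k|² : Re z > 0 } = ∞`. -/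
theorem resolvent_condition_fails_quantitative
    (lam' : ℤ → ℂ)
    (hlam'1 : ∀ k : ℤ, 1 ≤ k → lam' k = -((Real.exp (-(k : ℝ)) : ℝ) : ℂ) + Complex.I * (k : ℂ))
    (hlam'2 : ∀ k : ℤ, k ≤ 0 → lam' k = -((Real.sqrt (|(k : ℝ)| + 1) : ℝ) : ℂ))
    (b : ℤ → ℝ)
    (hb1 : ∀ k : ℤ, 1 ≤ k → b k = 1 / (k : ℝ))
    (hb0 : b 0 = 0)
    (hb2 : ∀ k : ℤ, k ≤ -1 → b k = |(k : ℝ)| ^ (-(1 / 2 : ℝ))) :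
    (∀ n : ℕ+,
      (0 : ℝ) < (((Real.exp (-((n : ℕ) : ℝ)) : ℝ) : ℂ) + Complex.I * ((n : ℕ) : ℂ)).re ∧
      Real.exp ((n : ℕ) : ℝ) / (4 * ((n : ℕ) : ℝ) ^ 2) ≤
        (((Real.exp (-((n : ℕ) : ℝ)) : ℝ) : ℂ) + Complex.I * ((n : ℕ) : ℂ)).re *
          ∑' k : ℤ,
            b k ^ 2 / ‖(((Real.exp (-((n : ℕ) : ℝ)) : ℝ) : ℂ) + Complex.I * ((n : ℕ) : ℂ)) - lam' k‖ ^ 2) ∧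
    (∀ C : ℝ, ∃ z : ℂ, 0 < z.re ∧
      C < z.re * ∑' k : ℤ, b k ^ 2 / ‖z - lam' k‖ ^ 2) := by
  have hre (n : ℕ+) :
      (((Real.exp (-((n : ℕ) : ℝ)) : ℝ) : ℂ) + Complex.I * ((n : ℕ) : ℂ)).re =
        Real.exp (-((n : ℕ) : ℝ)) := by
    simp [-Complex.ofReal_exp]
  have hpos (n : ℕ+) :
      (0 : ℝ) < (((Real.exp (-((n : ℕ) : ℝ)) : ℝ) : ℂ) + Complex.I * ((n : ℕ) : ℂ)).re := by
    rw [hre]; exact Real.exp_pos _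
  have hlower (n : ℕ+) :
      Real.exp ((n : ℕ) : ℝ) / (4 * ((n : ℕ) : ℝ) ^ 2) ≤
        (((Real.exp (-((n : ℕ) : ℝ)) : ℝ) : ℂ) + Complex.I * ((n : ℕ) : ℂ)).re *
          ∑' k : ℤ, b k ^ 2 /
            ‖(((Real.exp (-((n : ℕ) : ℝ)) : ℝ) : ℂ) + Complex.I * ((n : ℕ) : ℂ)) - lam' k‖ ^ 2 := by
    have hn : (1 : ℤ) ≤ ((n : ℕ) : ℤ) := by exact_mod_cast n.pos
    have hterm := (summable_sq_div_norm_sub_sq lam' hlam'1 hlam'2 b hb1 hb0 hb2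
      (hpos n)).le_tsum ((n : ℕ) : ℤ) fun k _ => by positivity
    refine le_trans (le_of_eq ?_) (mul_le_mul_of_nonneg_left hterm (hpos n).le)
    have hdiff : ((Real.exp (-((n : ℕ) : ℝ)) : ℝ) : ℂ) + Complex.I * ((n : ℕ) : ℂ) -
        lam' ((n : ℕ) : ℤ) = ((2 * Real.exp (-((n : ℕ) : ℝ)) : ℝ) : ℂ) := by
      rw [hlam'1 _ hn]
      push_cast
      ring
    rw [hdiff, hre, hb1 _ hn, Complex.norm_real, Real.norm_of_nonneg (by positivity),
      Real.exp_neg, Int.cast_natCast]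
    have hn0 : ((n : ℕ) : ℝ) ≠ 0 := by exact_mod_cast n.ne_zero
    field_simp
    norm_num
  refine ⟨fun n => ⟨hpos n, hlower n⟩, fun C => ?_⟩
  have hlim : Tendsto (fun n : ℕ => Real.exp (n : ℝ) / (n : ℝ) ^ 2) atTop atTop :=
    (Real.tendsto_exp_div_pow_atTop 2).comp tendsto_natCast_atTop_atTop
  obtain ⟨m, hm, hm0⟩ := ((hlim.eventually_gt_atTop (4 * C)).and (eventually_gt_atTop 0)).exists
  refine ⟨_, hpos ⟨m, hm0⟩, lt_of_lt_of_le ?_ (hlower ⟨m, hm0⟩)⟩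
  rw [PNat.mk_coe, mul_comm, ← div_div]
  linarith
end

section
/- For every t ≥ 0 the map T'(t) : ℓ²(ℤ,ℂ) → ℓ²(ℤ,ℂ), T'(t)x := (e^{λ'_k t} x_k)_{k∈ℤ}, is a well-defined bounded linear operator with operator norm exactly 1; moreover for every x ∈ ℓ²(ℤ,ℂ) one has ‖T'(t)x‖ → 0 as t → ∞. (Thus the diagonal semigroup generated by A' is a strongly stable contraction semigroup that is not exponentially stable.) -/
open MeasureTheory Filter

/-- A multiplier bounded by `1` preserves membership in `ℓ^p`. -/
theorem Memℓp.mul_of_norm_le_one {ι : Type*} {p : ENNReal} {m x : ι → ℂ} (hm : ∀ k, ‖m k‖ ≤ 1)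
    (hx : Memℓp x p) : Memℓp (fun k => m k * x k) p :=
  hx.mono' fun k => by
    rw [norm_mul]
    exact mul_le_of_le_one_left (norm_nonneg _) (hm k)

/-- The diagonal operator on `ℓ^p` with multiplier bounded by `1`. -/
noncomputable def lpDiagonal {ι : Type*} (p : ENNReal) [Fact (1 ≤ p)] (m : ι → ℂ)
    (hm : ∀ k, ‖m k‖ ≤ 1) : lp (fun _ : ι => ℂ) p →L[ℂ] lp (fun _ : ι => ℂ) p :=
  LinearMap.mkContinuous
    { toFun := fun x => ⟨fun k => m k * x k, (lp.memℓp x).mul_of_norm_le_one hm⟩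
      map_add' := fun x y => lp.ext <| funext fun k => mul_add (m k) (x k) (y k)
      map_smul' := fun c x => lp.ext <| funext fun k => mul_left_comm (m k) c (x k) }
    1 fun x => by
      rw [one_mul]
      refine lp.norm_mono (zero_lt_one.trans_le Fact.out).ne' fun k => ?_
      change ‖m k * x k‖ ≤ ‖x k‖
      rw [norm_mul]
      exact mul_le_of_le_one_left (norm_nonneg _) (hm k)

theorem lpDiagonal_apply {ι : Type*} (p : ENNReal) [Fact (1 ≤ p)] (m : ι → ℂ)
    (hm : ∀ k, ‖m k‖ ≤ 1) (x : lp (fun _ : ι => ℂ) p) (k : ι) :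
    lpDiagonal p m hm x k = m k * x k :=
  rfl

theorem norm_lpDiagonal_le {ι : Type*} (p : ENNReal) [Fact (1 ≤ p)] (m : ι → ℂ)
    (hm : ∀ k, ‖m k‖ ≤ 1) : ‖lpDiagonal p m hm‖ ≤ 1 :=
  LinearMap.mkContinuous_norm_le _ zero_le_one _

theorem norm_le_norm_lpDiagonal {ι : Type*} (p : ENNReal) [Fact (1 ≤ p)] (m : ι → ℂ)
    (hm : ∀ k, ‖m k‖ ≤ 1) (k : ι) : ‖m k‖ ≤ ‖lpDiagonal p m hm‖ := by
  classical
  have hp : 0 < p := zero_lt_one.trans_le Fact.out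
  have hcoord := lp.norm_apply_le_norm hp.ne'
    (lpDiagonal p m hm (lp.single p k (1 : ℂ))) k
  have hop := (lpDiagonal p m hm).le_opNorm (lp.single p k (1 : ℂ))
  rw [lpDiagonal_apply, lp.single_apply_self, mul_one] at hcoord
  rw [lp.norm_single hp, norm_one, mul_one] at hop
  exact hcoord.trans hop

theorem norm_exp_mul_ofReal (z : ℂ) (t : ℝ) :
    ‖Complex.exp (z * (t : ℂ))‖ = Real.exp (z.re * t) := by
  simp [Complex.norm_exp]

/-- If all rates have negative real part, the diagonal semigroup is strongly stable on `ℓ²`. -/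
theorem tendsto_sqrt_tsum_norm_exp_mul {ι : Type*} {a : ι → ℂ} (ha : ∀ k, (a k).re < 0)
    (x : lp (fun _ : ι => ℂ) 2) :
    Tendsto (fun t : ℝ => Real.sqrt (∑' k, ‖Complex.exp (a k * (t : ℂ)) * x k‖ ^ 2))
      atTop (nhds 0) := by
  have hsum : Summable fun k => ‖x k‖ ^ 2 := by
    simpa using (lp.memℓp x).summable (by norm_num)
  have hpt (k : ι) :
      Tendsto (fun t : ℝ => ‖Complex.exp (a k * (t : ℂ)) * x k‖ ^ 2) atTop (nhds 0) := by
    have hexp : Tendsto (fun t : ℝ => Real.exp ((a k).re * t)) atTop (nhds 0) :=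
      Real.tendsto_exp_atBot.comp (tendsto_id.const_mul_atTop_of_neg (ha k))
    simpa [norm_exp_mul_ofReal] using (hexp.mul_const ‖x k‖).pow 2
  have hbound : ∀ᶠ t : ℝ in atTop, ∀ k,
      ‖‖Complex.exp (a k * (t : ℂ)) * x k‖ ^ 2‖ ≤ ‖x k‖ ^ 2 := by
    filter_upwards [eventually_ge_atTop 0] with t ht k
    rw [norm_pow, norm_norm, norm_mul, norm_exp_mul_ofReal]
    gcongr
    exact mul_le_of_le_one_left (norm_nonneg _)
      (Real.exp_le_one_iff.2 (mul_nonpos_of_nonpos_of_nonneg (ha k).le ht))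
  simpa using (tendsto_tsum_of_dominated_convergence hsum hpt hbound).sqrt

/-- For `λ'_k = -e^{-k} + ik` (`k ≥ 1`) and `λ'_k = -(|k|+1)^{1/2}` (`k ≤ 0`), the diagonal
semigroup operators `T'(t) x = (e^{λ'_k t} x_k)_k` are, for every `t ≥ 0`, well-defined
bounded linear operators on `ℓ²(ℤ,ℂ)` of operator norm exactly `1`, and for every `x` one
has `‖T'(t) x‖ → 0` as `t → ∞` (strongly stable contraction semigroup, not exponentially
stable). -/
theorem perturbed_diagonal_semigroup_contractive_strongly_stable
    (lam' : ℤ → ℂ)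
    (hlam'1 : ∀ k : ℤ, 1 ≤ k → lam' k = -((Real.exp (-(k : ℝ)) : ℝ) : ℂ) + Complex.I * (k : ℂ))
    (hlam'2 : ∀ k : ℤ, k ≤ 0 → lam' k = -((Real.sqrt (|(k : ℝ)| + 1) : ℝ) : ℂ)) :
    (∀ t : ℝ, 0 ≤ t →
      (∀ x : lp (fun _ : ℤ => ℂ) 2,
        Memℓp (fun k : ℤ => Complex.exp (lam' k * (t : ℂ)) * x k) 2) ∧
      (∃ T : lp (fun _ : ℤ => ℂ) 2 →L[ℂ] lp (fun _ : ℤ => ℂ) 2,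
        (∀ (x : lp (fun _ : ℤ => ℂ) 2) (k : ℤ),
          T x k = Complex.exp (lam' k * (t : ℂ)) * x k) ∧ ‖T‖ = 1)) ∧
    (∀ x : lp (fun _ : ℤ => ℂ) 2,
      Tendsto
        (fun t : ℝ =>
          Real.sqrt (∑' k : ℤ, ‖Complex.exp (lam' k * (t : ℂ)) * x k‖ ^ 2))
        atTop (nhds 0)) := by
  have hre1 (k : ℤ) (hk : 1 ≤ k) : (lam' k).re = -Real.exp (-(k : ℝ)) := by
    rw [hlam'1 k hk, Complex.add_re, Complex.neg_re, Complex.ofReal_re]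
    simp
  have hre (k : ℤ) : (lam' k).re < 0 := by
    rcases le_or_gt 1 k with hk | hk
    · rw [hre1 k hk]
      exact neg_lt_zero.2 (Real.exp_pos _)
    · rw [hlam'2 k (by lia), Complex.neg_re, Complex.ofReal_re]
      exact neg_lt_zero.2 (Real.sqrt_pos.2 (by positivity))
  refine ⟨fun t ht => ?_, tendsto_sqrt_tsum_norm_exp_mul hre⟩
  have hm (k : ℤ) : ‖Complex.exp (lam' k * (t : ℂ))‖ ≤ 1 := by
    rw [norm_exp_mul_ofReal]
    exact Real.exp_le_one_iff.2 (mul_nonpos_of_nonpos_of_nonneg (hre k).le ht)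
  refine ⟨fun x => (lp.memℓp x).mul_of_norm_le_one hm,
    lpDiagonal 2 _ hm, lpDiagonal_apply 2 _ hm, le_antisymm (norm_lpDiagonal_le 2 _ hm) ?_⟩
  have hlim : Tendsto (fun n : ℕ => Real.exp (-Real.exp (-(n : ℝ)) * t)) atTop (nhds 1) := by
    have h0 : Tendsto (fun n : ℕ => Real.exp (-(n : ℝ))) atTop (nhds 0) :=
      Real.tendsto_exp_neg_atTop_nhds_zero.comp tendsto_natCast_atTop_atTop
    simpa using (h0.neg.mul_const t).rexp
  refine le_of_tendsto hlim ?_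
  filter_upwards [eventually_ge_atTop 1] with n hn
  have hle := norm_le_norm_lpDiagonal 2 _ hm (n : ℤ)
  rwa [norm_exp_mul_ofReal, hre1 n (by exact_mod_cast hn), Int.cast_natCast] at hle
end
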